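/- Let n be a positive integer divisible by 8 and let Γ = IOCG_n(D,σ) be an integral oriented circulant graph with Hermitian eigenvalues μ_0,…,μ_{n−1}, and assume D₂ = {d ∈ D : ν₂(n/d) = 2} = {n/4} and D₃ = {d ∈ D : ν₂(n/d) = 3} = {n/8}. Then for 0 ≤ j ≤ n−1: if j is odd, μ_j = 2·σ(n/4)·(−1)^{(j+1)/2}; if j ≡ 2 (mod 4), μ_j = 4·σ(n/8)·(−1)^{(j/2+1)/2}; and if j is divisible by 4, μ_j is divisible by 8. -/

import Mathlib

open Complex Finset

noncomputable section

/-- `G_n^r(d) = { dk : k ≡ r (mod 4), gcd(dk, n) = d } ⊆ {1, …, n−1}`. -/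
def Gsetr (n r d : ℕ) : Finset ℕ :=
  (Finset.range n).filter (fun a => d ∣ a ∧ (a / d) % 4 = r ∧ Nat.gcd a n = d)

/-- The symbol `C = ⋃_{d ∈ D} S_n(d)` of the integral oriented circulant graph
`IOCG_n(D, σ)`, where `S_n(d) = G_n^1(d)` if `σ d = 1` and `S_n(d) = G_n^3(d)` otherwise. -/
def symbol (n : ℕ) (D : Finset ℕ) (σ : ℕ → ℤ) : Finset ℕ :=
  D.biUnion (fun d => Gsetr n (if σ d = 1 then 1 else 3) d)

/-- The Hermitian adjacency matrix of the oriented circulant graph with symbol `C`. -/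
def hermMatrix (n : ℕ) [NeZero n] (C : Finset ℕ) : Matrix (ZMod n) (ZMod n) ℂ :=
  Matrix.of fun u v =>
    if (v - u).val ∈ C then Complex.I
    else if (u - v).val ∈ C then -Complex.I else 0

/-- The transition matrix `U(t) = exp(i t H)`. -/
def transitionMatrix (n : ℕ) [NeZero n] (C : Finset ℕ) (t : ℝ) :
    Matrix (ZMod n) (ZMod n) ℂ :=
  NormedSpace.exp ((Complex.I * (t : ℂ)) • hermMatrix n C)

/-- Perfect state transfer from `u` to `v`. -/
def hasPST (n : ℕ) [NeZero n] (C : Finset ℕ) (u v : ZMod n) : Prop :=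
  ∃ (t : ℝ) (γ : ℂ), ‖γ‖ = 1 ∧
    (transitionMatrix n C t).mulVec (Pi.single u 1) = γ • (Pi.single v 1 : ZMod n → ℂ)

/-- Multiple state transfer on a vertex set `S`: PST between every pair of
distinct vertices of `S`. -/
def hasMST (n : ℕ) [NeZero n] (C : Finset ℕ) (S : Set (ZMod n)) : Prop :=
  ∀ u ∈ S, ∀ v ∈ S, u ≠ v → hasPST n C u v

/-- The Hermitian eigenvalues `μ_j = i ∑_{k ∈ C} (ω^{jk} − ω^{−jk})`, `ω = exp(2πi/n)`. -/
def eigval (n : ℕ) (C : Finset ℕ) (j : ℕ) : ℂ :=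
  Complex.I * ∑ k ∈ C, (Complex.exp (2 * Real.pi * Complex.I * j * k / n) -
    Complex.exp (-(2 * Real.pi * Complex.I * j * k / n)))

/-- Ramanujan's sum `c_n(q) = ∑_{1 ≤ a ≤ n, gcd(a,n)=1} exp(2πi a q / n)`. -/
def ramanujanSum (n q : ℕ) : ℂ :=
  ∑ a ∈ (Finset.Icc 1 n).filter (fun a => Nat.gcd a n = 1),
    Complex.exp (2 * Real.pi * Complex.I * a * q / n)

/-- Ramanujan's sine sum `s_n(q) = i ∑_{a ∈ G_n^1(1)} (ω^{aq} − ω^{−aq})`. -/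
def sineSum (n q : ℕ) : ℂ :=
  Complex.I * ∑ a ∈ Gsetr n 1 1, (Complex.exp (2 * Real.pi * Complex.I * a * q / n) -
    Complex.exp (-(2 * Real.pi * Complex.I * a * q / n)))

/-- The sum of `z ^ k` over the residues `k` modulo `m` prime to `m` with `k ≡ r (mod 4)`. -/
def classSum (r m : ℕ) (z : ℂ) : ℂ :=
  ∑ k ∈ Finset.range m, if k % 4 = r ∧ k.Coprime m then z ^ k else 0

theorem sum_range_mul_of_quasiperiodic {f : ℕ → ℂ} {c : ℂ} {M : ℕ}
    (hf : ∀ k, f (k + M) = c * f k) (t : ℕ) :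
    ∑ k ∈ Finset.range (t * M), f k =
      (∑ i ∈ Finset.range t, c ^ i) * ∑ k ∈ Finset.range M, f k := by
  have key : ∀ i k, f (i * M + k) = c ^ i * f k := by
    intro i k
    induction i with
    | zero => simp
    | succ i ih =>
      rw [show (i + 1) * M + k = i * M + k + M by ring, hf, ih]
      ring
  induction t with
  | zero => simp
  | succ t ih =>
    rw [add_mul, one_mul, Finset.sum_range_add, ih, Finset.sum_range_succ, add_mul]
    simp only [key, Finset.mul_sum]

theorem sum_range_add_of_periodic {f : ℕ → ℂ} {M : ℕ} (hf : ∀ k, f (k + M) = f k) (c : ℕ) :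
    ∑ k ∈ Finset.range M, f (k + c) = ∑ k ∈ Finset.range M, f k := by
  induction c with
  | zero => simp
  | succ c ih =>
    have h := Finset.sum_range_succ' (fun k => f (k + c)) M
    rw [Finset.sum_range_succ] at h
    have h' : f (M + c) = f (0 + c) := by rw [add_comm M c, hf, zero_add]
    rw [h', ih] at h
    have h2 := add_right_cancel h
    rw [h2]
    refine Finset.sum_congr rfl fun k _ => ?_
    congr 1
    ring

theorem classSum_mul {r t M : ℕ} (ht : t ∣ M) (hM : 4 ∣ M) (z : ℂ) :
    classSum r (t * M) z = (∑ i ∈ Finset.range t, (z ^ M) ^ i) * classSum r M z := by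
  have hco : ∀ k : ℕ, k.Coprime (t * M) ↔ k.Coprime M := fun k => by
    rw [Nat.coprime_mul_iff_right]
    exact ⟨fun h => h.2, fun h => ⟨h.coprime_dvd_right ht, h⟩⟩
  unfold classSum
  simp only [hco]
  refine sum_range_mul_of_quasiperiodic (fun k => ?_) t
  have h1 : (k + M) % 4 = k % 4 := by omega
  simp only [h1, Nat.coprime_add_self_left, mul_ite, mul_zero, pow_add, mul_comm (z ^ k)]

theorem classSum_two_mul_eq_zero {r M : ℕ} (hM : 4 ∣ M) {z : ℂ} (hz : z ^ M = -1) :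
    classSum r (2 * M) z = 0 := by
  rw [classSum_mul (dvd_trans (by norm_num) hM) hM, hz]
  simp [Finset.sum_range_succ]

theorem classSum_four_mul_eq_zero {r M : ℕ} (hM : 4 ∣ M) {z : ℂ} (hz : z ^ M = -1) :
    classSum r (4 * M) z = 0 := by
  rw [classSum_mul hM hM, hz]
  simp only [Finset.sum_range_succ, Finset.sum_range_zero]
  ring

theorem isIntegral_classSum {r m : ℕ} {z : ℂ} (hz : IsIntegral ℤ z) :
    IsIntegral ℤ (classSum r m z) := by
  refine IsIntegral.sum _ fun k _ => ?_
  split_ifs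
  · exact hz.pow k
  · exact isIntegral_zero

theorem classSum_four_mul_odd_reflect {r u : ℕ} (hr : r % 2 = 1) (hu : u % 2 = 1)
    {z : ℂ} (hz : z ^ (4 * u) = 1) :
    classSum r (4 * u) z = z ^ (2 * u) * classSum r (4 * u) z⁻¹ := by
  have hz0 : z ≠ 0 := by
    rintro rfl
    rw [zero_pow (by omega)] at hz
    exact zero_ne_one hz
  set f : ℕ → ℂ := fun k => if k % 4 = r ∧ k.Coprime (4 * u) then z ^ k else 0 with hf
  have hper : ∀ k, f (k + 4 * u) = f k := fun k => by
    have h1 : (k + 4 * u) % 4 = k % 4 := by omega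
    simp only [hf, h1, Nat.coprime_add_self_left, pow_add, hz, mul_one]
  have hsum : classSum r (4 * u) z = ∑ k ∈ Finset.range (4 * u), f (k + (2 * u + 1)) :=
    (sum_range_add_of_periodic hper _).symm
  rw [hsum, ← Finset.sum_range_reflect, classSum, Finset.mul_sum]
  refine Finset.sum_congr rfl fun k hk => ?_
  rw [Finset.mem_range] at hk
  obtain ⟨l, hl⟩ : ∃ l, 4 * u - 1 - k + (2 * u + 1) = l := ⟨_, rfl⟩
  have hkl : k + l = 6 * u := by omega
  rw [hl]
  have hco : ∀ a b : ℕ, a + b = 6 * u → a % 2 = 1 → a.Coprime (4 * u) → b.Coprime (4 * u) := by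
    intro a b hab ha h
    refine Nat.Coprime.mul_right ?_ ?_
    · have : b.Coprime (2 ^ 2) := Nat.Coprime.pow_right 2
        (Nat.coprime_two_right.2 (Nat.odd_iff.2 (by omega)))
      simpa using this
    · have h1 : a.Coprime u := h.coprime_dvd_right (Dvd.intro_left 4 rfl)
      refine Nat.Coprime.symm (Nat.coprime_of_dvd fun p hp hpu hpb => ?_)
      have : p ∣ a := (Nat.dvd_add_left hpb).1 (hab ▸ Dvd.dvd.mul_left hpu 6)
      exact Nat.not_coprime_of_dvd_of_dvd hp.one_lt this hpu h1
  have hiff : (l % 4 = r ∧ l.Coprime (4 * u)) ↔ (k % 4 = r ∧ k.Coprime (4 * u)) := by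
    constructor
    · rintro ⟨h1, h2⟩
      exact ⟨by omega, hco l k (by omega) (by omega) h2⟩
    · rintro ⟨h1, h2⟩
      exact ⟨by omega, hco k l (by omega) (by omega) h2⟩
  simp only [hf, hiff, mul_ite, mul_zero]
  congr 1
  rw [inv_pow, ← div_eq_mul_inv, eq_div_iff (pow_ne_zero _ hz0), ← pow_add, add_comm l k, hkl,
    show 6 * u = 4 * u + 2 * u by ring, pow_add, hz, one_mul]

/-- The summand of the eigenvalue belonging to one divisor, in terms of `z = ω ^ (j * d)`. -/
def sineClassSum (r m : ℕ) (z : ℂ) : ℂ :=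
  I * (classSum r m z - classSum r m z⁻¹)

theorem isIntegral_of_pow_eq_one {z : ℂ} {m : ℕ} (hm : 0 < m) (hz : z ^ m = 1) :
    IsIntegral ℤ z :=
  IsIntegral.of_pow hm (hz ▸ isIntegral_one)

theorem sineClassSum_eq_two_mul {r M : ℕ} (hr : r % 2 = 1) (hM0 : 0 < M) (hM : 4 ∣ M)
    {z : ℂ} (hz : z ^ M = 1) : ∃ w : ℂ, IsIntegral ℤ w ∧ sineClassSum r M z = 2 * w := by
  have hz' : z⁻¹ ^ M = 1 := by rw [inv_pow, hz, inv_one]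
  have hI : IsIntegral ℤ I := isIntegral_of_pow_eq_one (m := 4) (by norm_num) I_pow_four
  have hzi := isIntegral_of_pow_eq_one hM0 hz
  have hzi' := isIntegral_of_pow_eq_one hM0 hz'
  unfold sineClassSum
  obtain ⟨u, rfl⟩ := hM
  have hsq : z ^ (2 * u) = 1 ∨ z ^ (2 * u) = -1 := by
    rw [← sq_eq_one_iff, ← pow_mul, ← hz]
    congr 1
    ring
  rcases Nat.mod_two_eq_zero_or_one u with hu | hu
  · have h4 : 4 ∣ 2 * u := by omega
    have h2 : 2 ∣ 2 * u := Dvd.intro _ rfl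
    rw [show 4 * u = 2 * (2 * u) by ring]
    rcases hsq with h | h
    · refine ⟨I * (classSum r (2 * u) z - classSum r (2 * u) z⁻¹),
        hI.mul ((isIntegral_classSum hzi).sub (isIntegral_classSum hzi')), ?_⟩
      rw [classSum_mul h2 h4, classSum_mul h2 h4, inv_pow, h]
      simp only [Finset.sum_range_succ, Finset.sum_range_zero, inv_one, one_pow]
      ring
    · refine ⟨0, isIntegral_zero, ?_⟩
      rw [classSum_two_mul_eq_zero h4 h, classSum_two_mul_eq_zero h4 (by rw [inv_pow, h]; norm_num)]
      simp
  · have hrefl := classSum_four_mul_odd_reflect hr hu hz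
    rcases hsq with h | h
    · refine ⟨0, isIntegral_zero, ?_⟩
      rw [hrefl, h]
      ring
    · refine ⟨I * classSum r (4 * u) z, hI.mul (isIntegral_classSum hzi), ?_⟩
      rw [h] at hrefl
      linear_combination (-I) * hrefl

theorem sineClassSum_eq_eight_mul {r M : ℕ} (hr : r % 2 = 1) (hM0 : 0 < M) (hM : 4 ∣ M)
    {z : ℂ} (hz : z ^ M = 1) :
    ∃ w : ℂ, IsIntegral ℤ w ∧ sineClassSum r (4 * M) z = 8 * w := by
  obtain ⟨w, hw, h⟩ := sineClassSum_eq_two_mul hr hM0 hM hz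
  refine ⟨w, hw, ?_⟩
  unfold sineClassSum at h ⊢
  rw [classSum_mul hM hM, classSum_mul hM hM, inv_pow, hz]
  simp only [Finset.sum_range_succ, Finset.sum_range_zero, inv_one, one_pow]
  linear_combination 4 * h

theorem classSum_four {r : ℕ} (hr : r = 1 ∨ r = 3) (z : ℂ) : classSum r 4 z = z ^ r := by
  rcases hr with rfl | rfl <;> simp [classSum, Finset.sum_range_succ]

theorem classSum_eight {r : ℕ} (hr : r = 1 ∨ r = 3) (z : ℂ) :
    classSum r 8 z = (1 + z ^ 4) * z ^ r := by
  rw [show 8 = 2 * 4 from rfl, classSum_mul (by norm_num) (dvd_refl 4), classSum_four hr]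
  simp [Finset.sum_range_succ]

theorem sum_Gsetr {n d : ℕ} (hn : 0 < n) (hd : d ∣ n) (r : ℕ) (z : ℂ) :
    ∑ k ∈ Gsetr n r d, z ^ k = classSum r (n / d) (z ^ d) := by
  obtain ⟨m, rfl⟩ := hd
  have hd0 : 0 < d := Nat.pos_of_mul_pos_right hn
  rw [Nat.mul_div_cancel_left m hd0, classSum, ← Finset.sum_filter]
  symm
  refine Finset.sum_bij (fun k _ => d * k) ?_ ?_ ?_ ?_
  · intro k hk
    simp only [Finset.mem_filter, Finset.mem_range, Gsetr] at hk ⊢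
    refine ⟨Nat.mul_lt_mul_of_pos_left hk.1 hd0, Dvd.intro _ rfl, ?_, ?_⟩
    · rw [Nat.mul_div_cancel_left k hd0]
      exact hk.2.1
    · rw [Nat.gcd_mul_left, hk.2.2, mul_one]
  · intro a _ b _ h
    exact Nat.eq_of_mul_eq_mul_left hd0 h
  · intro a ha
    simp only [Finset.mem_filter, Finset.mem_range, Gsetr] at ha
    obtain ⟨h1, ⟨k, rfl⟩, h2, h3⟩ := ha
    rw [Nat.mul_div_cancel_left k hd0] at h2
    rw [Nat.gcd_mul_left] at h3
    refine ⟨k, ?_, rfl⟩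
    simp only [Finset.mem_filter, Finset.mem_range]
    exact ⟨Nat.lt_of_mul_lt_mul_left h1, h2, Nat.eq_of_mul_eq_mul_left hd0 (by rw [h3, mul_one])⟩
  · intro k _
    rw [pow_mul]

theorem eigval_symbol {n : ℕ} (hn : 0 < n) {D : Finset ℕ} (hD : ∀ d ∈ D, d ∣ n) (σ : ℕ → ℤ)
    (j : ℕ) :
    eigval n (symbol n D σ) j = ∑ d ∈ D, sineClassSum (if σ d = 1 then 1 else 3) (n / d)
      (exp (2 * Real.pi * I / (n / d : ℕ)) ^ j) := by
  have hdisj : (D : Set ℕ).PairwiseDisjoint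
      (fun d => Gsetr n (if σ d = 1 then 1 else 3) d) := by
    intro a _ b _ hab
    refine Finset.disjoint_left.2 fun x hxa hxb => hab ?_
    simp only [Finset.mem_filter, Gsetr] at hxa hxb
    exact hxa.2.2.2.symm.trans hxb.2.2.2
  rw [eigval, symbol, Finset.sum_biUnion hdisj, Finset.mul_sum]
  refine Finset.sum_congr rfl fun d hd => ?_
  have hnC : (n : ℂ) ≠ 0 := by exact_mod_cast hn.ne'
  have hdC : (d : ℂ) ≠ 0 := by exact_mod_cast (Nat.pos_of_dvd_of_pos (hD d hd) hn).ne'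
  have hz : exp (2 * Real.pi * I / (n / d : ℕ)) ^ j = exp (2 * Real.pi * I * j / n) ^ d := by
    rw [← Complex.exp_nat_mul, ← Complex.exp_nat_mul, Nat.cast_div (hD d hd) hdC]
    congr 1
    field_simp
  rw [sineClassSum, hz, ← inv_pow, ← sum_Gsetr hn (hD d hd), ← sum_Gsetr hn (hD d hd),
    ← Finset.sum_sub_distrib]
  congr 1
  refine Finset.sum_congr rfl fun k _ => ?_
  rw [← Complex.exp_neg, ← Complex.exp_nat_mul, ← Complex.exp_nat_mul]
  congr 2 <;> ring

theorem exp_two_pi_mul_I_div_pow {m : ℕ} (hm : 0 < m) :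
    exp (2 * Real.pi * I / (m : ℕ)) ^ m = 1 :=
  (Complex.isPrimitiveRoot_exp m hm.ne').pow_eq_one

theorem exp_two_pi_mul_I_div_two_mul_pow {M : ℕ} (hM : 0 < M) :
    exp (2 * Real.pi * I / (2 * M : ℕ)) ^ M = -1 := by
  have h : (M : ℂ) ≠ 0 := by exact_mod_cast hM.ne'
  rw [← Complex.exp_nat_mul, ← Complex.exp_pi_mul_I]
  congr 1
  push_cast
  field_simp

theorem exp_two_pi_mul_I_div_four : exp (2 * Real.pi * I / (4 : ℕ)) = I := by
  refine Eq.trans (congrArg exp ?_) Complex.exp_pi_div_two_mul_I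
  push_cast
  ring

theorem exp_two_pi_mul_I_div_eight_sq : exp (2 * Real.pi * I / (8 : ℕ)) ^ 2 = I := by
  rw [← Complex.exp_nat_mul]
  refine Eq.trans (congrArg exp ?_) Complex.exp_pi_div_two_mul_I
  push_cast
  ring

theorem I_mul_I_pow_sub_inv {s : ℤ} (hs : s = 1 ∨ s = -1) {t : ℕ} (ht : Odd t) :
    I * ((I ^ t) ^ (if s = 1 then 1 else 3) - (I ^ t)⁻¹ ^ (if s = 1 then 1 else 3)) =
      2 * s * (-1) ^ ((t + 1) / 2) := by
  obtain ⟨c, rfl⟩ := ht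
  have h1 : I ^ (2 * c + 1) = (-1) ^ c * I := by rw [pow_succ, pow_mul, I_sq]
  have h2 : (2 * c + 1 + 1) / 2 = c + 1 := by omega
  have h3 : (I ^ (2 * c + 1))⁻¹ = -((-1) ^ c * I) := by
    rw [h1, mul_inv, inv_I, ← inv_pow, inv_neg, inv_one]
    ring
  rw [h3, h1, h2]
  rcases neg_one_pow_eq_or ℂ c with h | h <;> rcases hs with rfl | rfl <;>
    norm_num [pow_succ, h] <;> ring_nf <;> simp [I_sq]

theorem dvd_of_intCast_eq_mul_isIntegral {a b : ℤ} {w : ℂ} (hb : b ≠ 0) (hw : IsIntegral ℤ w)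
    (h : (a : ℂ) = b * w) : b ∣ a := by
  have hbC : (b : ℂ) ≠ 0 := by exact_mod_cast hb
  have hq : w = algebraMap ℚ ℂ (a / b) := by
    simp only [eq_ratCast, Rat.cast_div, Rat.cast_intCast]
    rw [h]
    field_simp
  rw [hq, isIntegral_algebraMap_iff (algebraMap ℚ ℂ).injective,
    IsIntegrallyClosed.isIntegral_iff] at hw
  obtain ⟨y, hy⟩ := hw
  refine ⟨y, ?_⟩
  have hbQ : (b : ℚ) ≠ 0 := by exact_mod_cast hb
  rw [eq_div_iff hbQ] at hy
  simp only [eq_intCast] at hy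
  rw [mul_comm]
  exact_mod_cast hy.symm

theorem eight_or_sixteen_dvd_of_padicValNat {m : ℕ} (hm : 0 < m) (h4 : 4 ∣ m)
    (h2 : padicValNat 2 m ≠ 2) : 8 ∣ m ∧ (padicValNat 2 m ≠ 3 → 16 ∣ m) := by
  have key : ∀ k, 2 ^ k ∣ m ↔ k ≤ padicValNat 2 m := fun k =>
    padicValNat_dvd_iff_le hm.ne'
  have := (key 2).1 (by simpa using h4)
  refine ⟨by simpa using (key 3).2 (by omega), fun h3 => by simpa using (key 4).2 (by omega)⟩

theorem eigval_of_D2_D3_singleton (n : ℕ) [NeZero n] (hn8 : 8 ∣ n)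
    (D : Finset ℕ) (hD : ∀ d ∈ D, d ∣ n / 4)
    (σ : ℕ → ℤ) (hσ : ∀ d ∈ D, σ d = 1 ∨ σ d = -1)
    (μ : ℕ → ℤ) (hμ : ∀ j < n, (μ j : ℂ) = eigval n (symbol n D σ) j)
    (hD2 : D.filter (fun d => padicValNat 2 (n / d) = 2) = {n / 4})
    (hD3 : D.filter (fun d => padicValNat 2 (n / d) = 3) = {n / 8}) :
    ∀ j < n, (Odd j → μ j = 2 * σ (n / 4) * (-1) ^ ((j + 1) / 2)) ∧
      (j % 4 = 2 → μ j = 4 * σ (n / 8) * (-1) ^ ((j / 2 + 1) / 2)) ∧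
      (4 ∣ j → (8 : ℤ) ∣ μ j) := by
  intro j hj
  have hn : 0 < n := Nat.pos_of_neZero n
  have hDn : ∀ d ∈ D, d ∣ n := fun d hd =>
    (hD d hd).trans (Nat.div_dvd_of_dvd (dvd_trans (by norm_num) hn8))
  have hm0 : ∀ d ∈ D, 0 < n / d := fun d hd =>
    Nat.div_pos (Nat.le_of_dvd hn (hDn d hd)) (Nat.pos_of_dvd_of_pos (hDn d hd) hn)
  have hm4 : ∀ d ∈ D, 4 ∣ n / d := fun d hd => by
    obtain ⟨e, he⟩ := hD d hd
    have hd0 := Nat.pos_of_dvd_of_pos (hDn d hd) hn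
    have : n = d * (4 * e) := by
      rw [mul_left_comm, ← he]
      omega
    rw [this, Nat.mul_div_cancel_left _ hd0]
    exact Dvd.intro _ rfl
  have hmem2 : n / 4 ∈ D := Finset.mem_of_mem_filter _ (hD2 ▸ Finset.mem_singleton_self _)
  have hmem3 : n / 8 ∈ D := Finset.mem_of_mem_filter _ (hD3 ▸ Finset.mem_singleton_self _)
  have hdiv4 : n / (n / 4) = 4 := Nat.div_div_self (dvd_trans (by norm_num) hn8) hn.ne'
  have hdiv8 : n / (n / 8) = 8 := Nat.div_div_self hn8 hn.ne'
  have hdvd8 : ∀ d ∈ D, d ≠ n / 4 → 8 ∣ n / d ∧ (d ≠ n / 8 → 16 ∣ n / d) := by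
    intro d hd hne
    have h2 : padicValNat 2 (n / d) ≠ 2 := fun h =>
      hne (Finset.mem_singleton.1 (hD2 ▸ Finset.mem_filter.2 ⟨hd, h⟩))
    have h := eight_or_sixteen_dvd_of_padicValNat (hm0 d hd) (hm4 d hd) h2
    refine ⟨h.1, fun hne' => h.2 fun h3 => hne' ?_⟩
    exact Finset.mem_singleton.1 (hD3 ▸ Finset.mem_filter.2 ⟨hd, h3⟩)
  have hr : ∀ d, (if σ d = 1 then 1 else 3) = 1 ∨ (if σ d = 1 then 1 else 3) = 3 := fun d => by
    split_ifs <;> simp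
  have hμj := (hμ j hj).trans (eigval_symbol hn hDn σ j)
  refine ⟨fun hodd => ?_, fun hj2 => ?_, fun hj4 => ?_⟩
  · rw [Finset.sum_eq_single (n / 4) ?_ (fun h => absurd hmem2 h), hdiv4, sineClassSum,
      classSum_four (hr _), classSum_four (hr _), exp_two_pi_mul_I_div_four,
      I_mul_I_pow_sub_inv (hσ _ hmem2) hodd] at hμj
    · exact_mod_cast hμj
    · intro d hd hne
      obtain ⟨M, hM⟩ := (hdvd8 d hd hne).1
      have hpos := hm0 d hd
      have h4 : 4 ∣ 4 * M := Dvd.intro _ rfl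
      rw [hM, show 8 * M = 2 * (4 * M) by ring, sineClassSum]
      have hz : (exp (2 * Real.pi * I / (2 * (4 * M) : ℕ)) ^ j) ^ (4 * M) = -1 := by
        rw [pow_right_comm, exp_two_pi_mul_I_div_two_mul_pow (by omega), hodd.neg_one_pow]
      rw [classSum_two_mul_eq_zero h4 hz,
        classSum_two_mul_eq_zero h4 (by rw [inv_pow, hz]; norm_num)]
      simp
  · obtain ⟨t, rfl⟩ : ∃ t, j = 2 * t := ⟨j / 2, by omega⟩
    have ht : Odd t := Nat.odd_iff.2 (by omega)
    have hI4 : (I ^ t) ^ 4 = 1 := by rw [pow_right_comm, I_pow_four, one_pow]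
    rw [Nat.mul_div_cancel_left t (by norm_num)]
    rw [Finset.sum_eq_single (n / 8) ?_ (fun h => absurd hmem3 h), hdiv8, sineClassSum,
      classSum_eight (hr _), classSum_eight (hr _), pow_mul, exp_two_pi_mul_I_div_eight_sq,
      inv_pow _ 4, hI4, inv_one] at hμj
    · have h := I_mul_I_pow_sub_inv (hσ _ hmem3) ht
      have h' : (μ (2 * t) : ℂ) = 4 * σ (n / 8) * (-1) ^ ((t + 1) / 2) := by
        rw [hμj]
        linear_combination 2 * h
      exact_mod_cast h'
    · intro d hd hne
      by_cases hne2 : d = n / 4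
      · subst hne2
        have hz : (I ^ (2 * t)) = -1 := by rw [pow_mul, I_sq, ht.neg_one_pow]
        rw [hdiv4, sineClassSum, classSum_four (hr _), classSum_four (hr _),
          exp_two_pi_mul_I_div_four, hz, inv_neg, inv_one, sub_self, mul_zero]
      · obtain ⟨M, hM⟩ := (hdvd8 d hd hne2).2 hne
        have hpos := hm0 d hd
        have h4 : 4 ∣ 4 * M := Dvd.intro _ rfl
        rw [hM, show 16 * M = 4 * (4 * M) by ring, sineClassSum]
        have hz : (exp (2 * Real.pi * I / (4 * (4 * M) : ℕ)) ^ (2 * t)) ^ (4 * M) = -1 := by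
          rw [show 4 * (4 * M) = 2 * (2 * (4 * M)) by ring, ← pow_mul,
            show 2 * t * (4 * M) = 2 * (4 * M) * t by ring, pow_mul,
            exp_two_pi_mul_I_div_two_mul_pow (by omega), ht.neg_one_pow]
        rw [classSum_four_mul_eq_zero h4 hz,
          classSum_four_mul_eq_zero h4 (by rw [inv_pow, hz]; norm_num)]
        simp
  · obtain ⟨t, rfl⟩ := hj4
    have hterm : ∀ d ∈ D, ∃ w : ℂ, IsIntegral ℤ w ∧
        sineClassSum (if σ d = 1 then 1 else 3) (n / d)
          (exp (2 * Real.pi * I / (n / d : ℕ)) ^ (4 * t)) = 8 * w := by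
      intro d hd
      by_cases hne2 : d = n / 4
      · subst hne2
        refine ⟨0, isIntegral_zero, ?_⟩
        rw [hdiv4, sineClassSum, exp_two_pi_mul_I_div_four, pow_mul, I_pow_four, one_pow, inv_one]
        simp
      by_cases hne3 : d = n / 8
      · subst hne3
        refine ⟨0, isIntegral_zero, ?_⟩
        have hz : exp (2 * Real.pi * I / (8 : ℕ)) ^ 4 = -1 := by
          rw [show 4 = 2 * 2 from rfl, pow_mul, exp_two_pi_mul_I_div_eight_sq, I_sq]
        rw [hdiv8, sineClassSum, pow_mul, hz, ← inv_pow, inv_neg, inv_one]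
        simp
      obtain ⟨M, hM⟩ := (hdvd8 d hd hne2).2 hne3
      have hpos := hm0 d hd
      rw [hM, show 16 * M = 4 * (4 * M) by ring]
      refine sineClassSum_eq_eight_mul (by rcases hr d with h | h <;> rw [h]) (by omega)
        (Dvd.intro _ rfl) ?_
      rw [← pow_mul, show 4 * t * (4 * M) = 4 * (4 * M) * t by ring, pow_mul,
        exp_two_pi_mul_I_div_pow (by omega), one_pow]
    choose! w hw hwe using hterm
    rw [Finset.sum_congr rfl hwe, ← Finset.mul_sum] at hμj
    exact dvd_of_intCast_eq_mul_isIntegral (by norm_num) (IsIntegral.sum _ hw) (by exact_mod_cast hμj)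

end
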